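/- Fix ε > 0. Suppose f : ℕ → ℕ satisfies f(n) ≤ n for all n and f(n) ≥ c·n^{1/3+ε} for some constant c > 0 and all sufficiently large n. For each n let Φₙ ~ F₂(n,n) and let Lₙ ⊆ ±[n] be an arbitrary consistent set with |Lₙ| = f(n). Then lim_{n→∞} P((Φₙ)_{Lₙ} ∈ SAT) = 0. -/

import Mathlib

open Filter Topology

noncomputable section

/-- The set of literals `±[n] = {−n,…,−1,1,…,n}`. -/
def pmSet (n : ℕ) : Finset ℤ := (Finset.Icc (-(n : ℤ)) n).filter (fun l => l ≠ 0)

/-- 2-clauses over `n` variables: pairs `(ℓ₁, ℓ₂)` of literals with `|ℓ₁| < |ℓ₂|`. -/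
def clauseSet (n : ℕ) : Finset (ℤ × ℤ) :=
  ((pmSet n) ×ˢ (pmSet n)).filter (fun c => |c.1| < |c.2|)

/-- 2-CNF formulas with `n` variables and `m` clauses (ordered lists of clauses). -/
def CNF2 (n m : ℕ) : Type := Fin m → clauseSet n

instance (n m : ℕ) : Fintype (CNF2 n m) := by unfold CNF2; infer_instance

/-- Evaluation of a literal `l ∈ ±[n]` at an assignment. -/
def litEval (x : ℕ → Bool) (l : ℤ) : Bool := if 0 < l then x l.natAbs else !(x l.natAbs)

/-- Evaluation of a 2-clause at an assignment. -/
def clauseEval (x : ℕ → Bool) (c : ℤ × ℤ) : Bool := litEval x c.1 || litEval x c.2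

/-- `L ⊆ ±[n]` is consistent: `l ∈ L → -l ∉ L`. -/
def Consistent (n : ℕ) (L : Finset ℤ) : Prop := L ⊆ pmSet n ∧ ∀ l ∈ L, -l ∉ L

/-- The assignment `x_L`: coordinates indicated by `L` are fixed. -/
def fixAssign (L : Finset ℤ) (x : ℕ → Bool) : ℕ → Bool :=
  fun v => if (v : ℤ) ∈ L then true else if -(v : ℤ) ∈ L then false else x v

/-- `φ_L ∈ SAT`: the formula `φ` with the variables indicated by `L` fixed is satisfiable. -/
def SatFixed {n m : ℕ} (L : Finset ℤ) (φ : CNF2 n m) : Prop :=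
  ∃ x : ℕ → Bool, ∀ j : Fin m, clauseEval (fixAssign L x) ((φ j : ℤ × ℤ)) = true

/-- `P(Φ_L ∈ SAT)` for `Φ ~ F₂(n,m)`, i.e. uniform counting over all formulas. -/
def probSatFixed (n m : ℕ) (L : Finset ℤ) : ℝ :=
  (Nat.card {φ : CNF2 n m // SatFixed L φ} : ℝ) / (Fintype.card (CNF2 n m) : ℝ)

/-- Second moment method, in counting form. -/
lemma sum_card_le_mul_card_exists {Ω ι : Type*} [Fintype Ω] (s : Finset ι) (A : ι → Ω → Prop)
    (B : ℝ) (hB : 0 ≤ B)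
    (h : ∀ P ∈ s, ∑ Q ∈ s, (Nat.card {ω // A P ω ∧ A Q ω} : ℝ) ≤ B * Nat.card {ω // A P ω}) :
    ∑ P ∈ s, (Nat.card {ω // A P ω} : ℝ) ≤ B * Nat.card {ω // ∃ P ∈ s, A P ω} := by
  classical
  have card_eq : ∀ p : Ω → Prop, (Nat.card {ω // p ω} : ℝ) = ∑ ω, if p ω then 1 else 0 := by
    intro p
    rw [Nat.card_eq_fintype_card, Fintype.card_subtype, Finset.sum_boole]
  set X : Ω → ℝ := fun ω => ∑ P ∈ s, if A P ω then 1 else 0 with hX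
  set G : Ω → ℝ := fun ω => if ∃ P ∈ s, A P ω then 1 else 0 with hG
  have hX0 : ∀ ω, 0 ≤ X ω := fun ω => Finset.sum_nonneg fun P _ => by split_ifs <;> norm_num
  have hsum : ∑ P ∈ s, (Nat.card {ω // A P ω} : ℝ) = ∑ ω, X ω := by
    rw [Finset.sum_comm]
    exact Finset.sum_congr rfl fun P _ => card_eq _
  have hXG : ∀ ω, X ω = X ω * G ω := by
    intro ω
    by_cases hω : ∃ P ∈ s, A P ω
    · simp [hG, hω]
    · have : X ω = 0 := Finset.sum_eq_zero fun P hP => by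
        rw [if_neg fun hA => hω ⟨P, hP, hA⟩]
      simp [this]
  have hsq : ∑ ω, X ω ^ 2 ≤ B * ∑ ω, X ω := by
    calc ∑ ω, X ω ^ 2
        = ∑ P ∈ s, ∑ Q ∈ s, (Nat.card {ω // A P ω ∧ A Q ω} : ℝ) := by
          simp_rw [card_eq, hX, sq, Finset.sum_mul_sum]
          rw [Finset.sum_comm]
          refine Finset.sum_congr rfl fun P _ => ?_
          rw [Finset.sum_comm]
          refine Finset.sum_congr rfl fun Q _ => Finset.sum_congr rfl fun ω _ => ?_
          by_cases h1 : A P ω <;> by_cases h2 : A Q ω <;> simp [h1, h2]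
      _ ≤ ∑ P ∈ s, B * (Nat.card {ω // A P ω} : ℝ) := Finset.sum_le_sum h
      _ = B * ∑ ω, X ω := by rw [← Finset.mul_sum, hsum]
  have hcs : (∑ ω, X ω) ^ 2 ≤ (∑ ω, X ω ^ 2) * ∑ ω, G ω := by
    have hG2 : ∑ ω, G ω = ∑ ω, G ω ^ 2 := Finset.sum_congr rfl fun ω _ => by
      simp only [hG]; split_ifs <;> norm_num
    rw [hG2, Finset.sum_congr rfl fun ω _ => hXG ω]
    exact Finset.sum_mul_sq_le_sq_mul_sq _ _ _
  have hG0 : 0 ≤ ∑ ω, G ω := Finset.sum_nonneg fun ω _ => by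
    simp only [hG]; split_ifs <;> norm_num
  rw [hsum, card_eq]
  refine le_of_le_of_eq (b := B * ∑ ω, G ω) ?_ (by simp only [hG]; congr!)
  rcases (Finset.sum_nonneg fun ω _ => hX0 ω : 0 ≤ ∑ ω, X ω).eq_or_lt with h0 | h0
  · rw [← h0]; positivity
  · refine le_of_mul_le_mul_right ?_ h0
    nlinarith [mul_le_mul_of_nonneg_right hsq hG0]

/-- The factor by which prescribing the value `k` at coordinate `i` changes the number of functions
into a `C`-element set that already satisfy `φ (e j) = c j` for all `j`. -/
def overlapWeight {I α : Type*} {t : ℕ} (C : ℕ) (e : Fin t → I) (c : Fin t → α) (i : I) (k : α) :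
    ℝ :=
  open Classical in
  if ∃ j, e j = i then (if ∃ j, e j = i ∧ c j = k then 1 else 0) else 1 / (C : ℝ)

lemma overlapWeight_nonneg {I α : Type*} {t : ℕ} (C : ℕ) (e : Fin t → I) (c : Fin t → α) (i : I)
    (k : α) : 0 ≤ overlapWeight C e c i k := by
  unfold overlapWeight
  split_ifs <;> positivity

lemma card_not_mem_range {I : Type*} [Fintype I] {t : ℕ} {e : Fin t → I}
    (he : Function.Injective e) [DecidablePred fun i => ∃ j, e j = i] :
    (Finset.univ.filter fun i => ¬ ∃ j, e j = i).card = Fintype.card I - t := by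
  classical
  have h := Finset.card_filter_add_card_filter_not (s := (Finset.univ : Finset I))
    (fun i => ∃ j, e j = i)
  have h2 : (Finset.univ.filter fun i => ∃ j, e j = i).card = t := by
    rw [show (Finset.univ.filter fun i => ∃ j, e j = i) = Finset.univ.image e by
      ext; simp, Finset.card_image_of_injective _ he, Finset.card_univ, Fintype.card_fin]
  rw [Finset.card_univ] at h
  omega

lemma card_prescribed {I α : Type*} [Fintype I] (s : Finset α) {t : ℕ} {e : Fin t → I}
    (he : Function.Injective e) (c : Fin t → α) (hc : ∀ j, c j ∈ s) :
    Nat.card {φ : I → s // ∀ j, (φ (e j) : α) = c j} = s.card ^ (Fintype.card I - t) := by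
  classical
  rw [Nat.card_eq_fintype_card, Fintype.card_subtype]
  have : (Finset.univ.filter fun φ : I → s => ∀ j, (φ (e j) : α) = c j) =
      Fintype.piFinset fun i => Finset.univ.filter fun k : s => ∀ j, e j = i → (k : α) = c j := by
    ext φ
    simp only [Finset.mem_filter, Finset.mem_univ, true_and, Fintype.mem_piFinset]
    exact ⟨fun h i j hj => hj ▸ h j, fun h j => h _ j rfl⟩
  rw [this, Fintype.card_piFinset, ← card_not_mem_range he, ← Finset.prod_const,
    Finset.prod_filter]
  refine Finset.prod_congr rfl fun i _ => ?_
  split_ifs with hi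
  · obtain ⟨j, rfl⟩ := hi
    rw [Finset.card_eq_one]
    refine ⟨⟨c j, hc j⟩, ?_⟩
    ext k
    simp only [Finset.mem_filter, Finset.mem_univ, true_and, Finset.mem_singleton, Subtype.ext_iff]
    exact ⟨fun h => h j rfl, fun h j' hj' => he hj' ▸ h⟩
  · push Not at hi
    rw [Finset.filter_true_of_mem fun k _ j hj => absurd hj (hi j)]
    simp

lemma card_prescribed_pair_le {I α : Type*} [Fintype I] (s : Finset α) (hs : s.Nonempty)
    {t u : ℕ} {e : Fin t → I} (he : Function.Injective e) (c : Fin t → α)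
    {e' : Fin u → I} (he' : Function.Injective e') (d : Fin u → α) :
    (Nat.card {φ : I → s // (∀ j, (φ (e j) : α) = c j) ∧ ∀ j, (φ (e' j) : α) = d j} : ℝ) ≤
      (s.card : ℝ) ^ (Fintype.card I - t) * ∏ j, overlapWeight s.card e c (e' j) (d j) := by
  classical
  have hC : (0 : ℝ) < s.card := by exact_mod_cast hs.card_pos
  rw [Nat.card_eq_fintype_card, Fintype.card_subtype]
  set F : I → Finset s := fun i => Finset.univ.filter fun k : s =>
    (∀ j, e j = i → (k : α) = c j) ∧ ∀ j, e' j = i → (k : α) = d j with hF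
  have : (Finset.univ.filter fun φ : I → s =>
      (∀ j, (φ (e j) : α) = c j) ∧ ∀ j, (φ (e' j) : α) = d j) = Fintype.piFinset F := by
    ext φ
    simp only [hF, Finset.mem_filter, Finset.mem_univ, true_and, Fintype.mem_piFinset]
    exact ⟨fun h i => ⟨fun j hj => hj ▸ h.1 j, fun j hj => hj ▸ h.2 j⟩,
      fun h => ⟨fun j => (h _).1 j rfl, fun j => (h _).2 j rfl⟩⟩
  rw [this, Fintype.card_piFinset, ← card_not_mem_range he, ← Finset.prod_const,
    Finset.prod_filter, ← Finset.prod_fiberwise (s := Finset.univ) (g := e'),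
    ← Finset.prod_mul_distrib]
  push_cast
  refine Finset.prod_le_prod (fun i _ => by positivity) fun i _ => ?_
  have hone : ∀ v : α, (∀ k ∈ F i, (k : α) = v) → ((F i).card : ℝ) ≤ 1 := by
    intro v hv
    have : (F i).card ≤ 1 := Finset.card_le_one.2 fun x hx y hy =>
      Subtype.ext ((hv x hx).trans (hv y hy).symm)
    exact_mod_cast this
  by_cases hj' : ∃ j', e' j' = i
  · obtain ⟨j', rfl⟩ := hj'
    have hfib : (Finset.univ.filter fun j => e' j = e' j') = {j'} := by
      ext j; simp [he'.eq_iff]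
    rw [hfib, Finset.prod_singleton]
    have h1 : ((F (e' j')).card : ℝ) ≤ 1 := hone (d j') fun k hk =>
      (Finset.mem_filter.1 hk).2.2 j' rfl
    unfold overlapWeight
    by_cases hj : ∃ j, e j = e' j'
    · rw [if_neg (not_not.2 hj), if_pos hj]
      split_ifs with h2
      · simpa using h1
      · have : F (e' j') = ∅ := by
          obtain ⟨j, hj⟩ := hj
          refine Finset.eq_empty_of_forall_notMem fun k hk => h2 ⟨j, hj, ?_⟩
          have hk := (Finset.mem_filter.1 hk).2
          rw [← hk.1 j hj, hk.2 j' rfl]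
        simp [this]
    · rw [if_pos hj, if_neg hj, mul_one_div_cancel hC.ne']
      exact h1
  · have hfib : (Finset.univ.filter fun j => e' j = i) = ∅ := by
      push Not at hj'
      exact Finset.filter_false_of_mem fun j _ => hj' j
    rw [hfib, Finset.prod_empty, mul_one]
    split_ifs with hj
    · obtain ⟨j, hj⟩ := hj
      exact hone (c j) fun k hk => (Finset.mem_filter.1 hk).2.1 j hj
    · have : (F i).card ≤ Fintype.card s := Finset.card_le_univ _
      rw [Fintype.card_coe] at this
      exact_mod_cast this

lemma sum_overlapWeight_le {I α : Type*} [Fintype I] [DecidableEq α] (C : ℕ) {t : ℕ}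
    (e : Fin t → I) (c : Fin t → α) (k : α) :
    ∑ i, overlapWeight C e c i k ≤
      (Fintype.card I : ℝ) / C + ∑ j, if c j = k then (1 : ℝ) else 0 := by
  classical
  have h : ∀ i, overlapWeight C e c i k ≤
      1 / (C : ℝ) + ∑ j, if e j = i ∧ c j = k then (1 : ℝ) else 0 := by
    intro i
    have hnn : 0 ≤ ∑ j, if e j = i ∧ c j = k then (1 : ℝ) else 0 :=
      Finset.sum_nonneg fun j _ => by split_ifs <;> norm_num
    have hC : 0 ≤ 1 / (C : ℝ) := by positivity
    unfold overlapWeight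
    split_ifs with h1 h2
    · obtain ⟨j, hj⟩ := h2
      have := Finset.single_le_sum (f := fun j => if e j = i ∧ c j = k then (1 : ℝ) else 0)
        (fun j _ => by split_ifs <;> norm_num) (Finset.mem_univ j)
      rw [if_pos hj] at this
      linarith
    · linarith
    · linarith
  refine (Finset.sum_le_sum fun i _ => h i).trans (le_of_eq ?_)
  rw [Finset.sum_add_distrib, Finset.sum_comm]
  congr 1
  · simp [div_eq_mul_inv]
  · refine Finset.sum_congr rfl fun j _ => ?_
    by_cases hj : c j = k <;> simp [hj]

/-- Total weight of the `s`-step walks from `x`, with transition weights `K` and terminal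
weight `z`. -/
def walkWeight {V : Type*} [Fintype V] (K : V → V → ℝ) (z : V → ℝ) : ℕ → V → ℝ
  | 0 => z
  | s + 1 => fun x => ∑ y, K x y * walkWeight K z s y

lemma sum_walks_eq {V : Type*} [Fintype V] (K : V → V → ℝ) (z : V → ℝ) (s : ℕ) (q : V → ℝ) :
    ∑ b : Fin (s + 1) → V,
        q (b 0) * (∏ j : Fin s, K (b j.castSucc) (b j.succ)) * z (b (Fin.last s)) =
      ∑ x, q x * walkWeight K z s x := by
  induction s generalizing q with
  | zero =>
    rw [← (Equiv.funUnique (Fin 1) V).symm.sum_comp]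
    simp [walkWeight]
  | succ s ih =>
    rw [← (Fin.consEquiv fun _ : Fin (s + 2) => V).sum_comp, Fintype.sum_prod_type,
      Finset.sum_comm]
    have h := ih fun y => ∑ x, q x * K x y
    simp only [Finset.sum_mul] at h
    rw [Finset.sum_comm (γ := V)] at h
    simp only [walkWeight, Finset.mul_sum]
    rw [Finset.sum_comm]
    refine Eq.trans ?_ (h.trans ?_)
    · rw [Finset.sum_comm]
      refine Finset.sum_congr rfl fun x _ => Finset.sum_congr rfl fun b _ => ?_
      rw [Fin.prod_univ_succ]
      simp only [Fin.consEquiv, Equiv.coe_fn_mk, Fin.cons_zero, Fin.castSucc_zero, Fin.cons_succ,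
        ← Fin.succ_castSucc, ← Fin.succ_last]
      ring
    · refine Finset.sum_congr rfl fun x _ => Finset.sum_congr rfl fun b _ => ?_
      ring

lemma walkWeight_nonneg {V : Type*} [Fintype V] {K : V → V → ℝ} (hK : ∀ x y, 0 ≤ K x y) {z : V → ℝ} (hz : ∀ x, 0 ≤ z x)
    (s : ℕ) (x : V) : 0 ≤ walkWeight K z s x := by
  induction s generalizing x with
  | zero => exact hz x
  | succ s ih => exact Finset.sum_nonneg fun y _ => mul_nonneg (hK x y) (ih y)

lemma sum_walkWeight_succ {V : Type*} [Fintype V] (K : V → V → ℝ) (z : V → ℝ) (T : ℕ) (x : V) :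
    ∑ s ∈ Finset.range T, walkWeight K z (s + 1) x =
      ∑ y, K x y * ∑ s ∈ Finset.range T, walkWeight K z s y := by
  simp only [walkWeight, Finset.mul_sum]
  exact Finset.sum_comm

/-- A sequence of literals on distinct variables, leading from a literal of `L` to the negation of
a literal of `L`, whose interior literals avoid the variables of `L`. -/
structure IsLinkingPath {V : Type*} [InvolutiveNeg V] (L : Finset V) {t : ℕ}
    (a : Fin (t + 1) → V) : Prop where
  inj : Function.Injective a
  ne_neg : ∀ i j, a i ≠ -a j
  head : a 0 ∈ L
  last : -a (Fin.last t) ∈ L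
  eq_zero : ∀ i, a i ∈ L → i = 0
  eq_last : ∀ i, -a i ∈ L → i = Fin.last t

section PathKernel

variable {V : Type*} [DecidableEq V] [InvolutiveNeg V] {t : ℕ}

/-- Sum of the values of `U` over the out-neighbours of `x` in the implication digraph of the
path `a`. -/
def pathStep (a : Fin (t + 1) → V) (U : V → ℝ) (x : V) : ℝ :=
  ∑ j : Fin t, ((if x = a j.castSucc then U (a j.succ) else 0) +
    if x = -a j.succ then U (-a j.castSucc) else 0)

/-- The constant kernel `p` plus the adjacency matrix of the implication digraph of `a`. -/
def pathKernel (p : ℝ) (a : Fin (t + 1) → V) (x y : V) : ℝ :=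
  p + ∑ j : Fin t, ((if x = a j.castSucc ∧ y = a j.succ then 1 else 0) +
    if x = -a j.succ ∧ y = -a j.castSucc then 1 else 0)

lemma pathKernel_nonneg {p : ℝ} (hp : 0 ≤ p) (a : Fin (t + 1) → V) (x y : V) :
    0 ≤ pathKernel p a x y := by
  refine add_nonneg hp (Finset.sum_nonneg fun j _ => add_nonneg ?_ ?_) <;> split_ifs <;> norm_num

lemma sum_pathKernel_mul [Fintype V] (p : ℝ) (a : Fin (t + 1) → V) (U : V → ℝ) (x : V) :
    ∑ y, pathKernel p a x y * U y = p * ∑ y, U y + pathStep a U x := by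
  simp only [pathKernel, pathStep, add_mul, Finset.sum_mul, Finset.sum_add_distrib, ite_and,
    ← Finset.mul_sum]
  congr 2
  all_goals
    rw [Finset.sum_comm]
    refine Finset.sum_congr rfl fun j _ => ?_
    split_ifs <;> simp

variable {L : Finset V} {a : Fin (t + 1) → V} {U : V → ℝ} {g : ℝ}

lemma sum_pathStep_le [Fintype V] (hg : ∀ x, U x ≤ g) : ∑ x, pathStep a U x ≤ 2 * t * g := by
  simp only [pathStep]
  rw [Finset.sum_comm]
  simp only [Finset.sum_add_distrib, Finset.sum_ite_eq', Finset.mem_univ, if_true]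
  calc _ ≤ ∑ _j : Fin t, g + ∑ _j : Fin t, g :=
        add_le_add (Finset.sum_le_sum fun _ _ => hg _) (Finset.sum_le_sum fun _ _ => hg _)
    _ = 2 * t * g := by simp; ring

lemma sum_ite_le_of_unique {ι : Type*} [Fintype ι] (P : ι → Prop) [DecidablePred P]
    (hP : ∀ i j, P i → P j → i = j) (F : ι → ℝ) (hg0 : 0 ≤ g) (hF : ∀ i, P i → F i ≤ g) :
    ∑ i, (if P i then F i else 0) ≤ g := by
  by_cases h : ∃ i, P i
  · obtain ⟨i, hi⟩ := h
    rw [Finset.sum_eq_single i (fun j _ hj => if_neg fun h => hj (hP _ _ h hi)) (by simp),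
      if_pos hi]
    exact hF i hi
  · push Not at h
    simpa [h] using hg0

lemma IsLinkingPath.sum_mem_pathStep_le (ha : IsLinkingPath L a) (hg0 : 0 ≤ g)
    (hg : ∀ x, U x ≤ g) : ∑ x ∈ L, pathStep a U x ≤ 2 * g := by
  simp only [pathStep]
  rw [Finset.sum_comm]
  simp only [Finset.sum_add_distrib, Finset.sum_ite_eq', two_mul]
  refine add_le_add (sum_ite_le_of_unique _ (fun i j hi hj => ?_) _ hg0 fun _ _ => hg _)
    (sum_ite_le_of_unique _ (fun i j hi hj => ?_) _ hg0 fun _ _ => hg _)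
  · exact Fin.castSucc_injective _ ((ha.eq_zero _ hi).trans (ha.eq_zero _ hj).symm)
  · exact Fin.succ_injective _ ((ha.eq_last _ hi).trans (ha.eq_last _ hj).symm)

lemma IsLinkingPath.indicator_add_pathStep_le (ha : IsLinkingPath L a) (hg1 : 1 ≤ g)
    (hg : ∀ x, U x ≤ g) (x : V) : (if -x ∈ L then 1 else 0) + pathStep a U x ≤ g := by
  have hg0 : 0 ≤ g := zero_le_one.trans hg1
  simp only [pathStep, Finset.sum_add_distrib]
  by_cases hx : ∃ i, x = a i
  · obtain ⟨i, rfl⟩ := hx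
    have h2 : ∑ j : Fin t, (if a i = -a j.succ then U (-a j.castSucc) else 0) = 0 :=
      Finset.sum_eq_zero fun j _ => if_neg (ha.ne_neg _ _)
    rw [h2, add_zero]
    split_ifs with hi
    · rw [Finset.sum_eq_zero, add_zero]
      · exact hg1
      · intro j _
        rw [if_neg]
        rw [ha.eq_last i hi, ha.inj.eq_iff]
        exact (Fin.castSucc_lt_last j).ne'
    · rw [zero_add]
      exact sum_ite_le_of_unique _ (fun j k hj hk =>
        Fin.castSucc_injective _ (ha.inj (hj.symm.trans hk))) _ hg0 fun _ _ => hg _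
  · push Not at hx
    rw [Finset.sum_eq_zero fun j _ => if_neg (hx _), zero_add]
    split_ifs with hi
    · rw [Finset.sum_eq_zero, add_zero]
      · exact hg1
      · intro j _
        rw [if_neg]
        rintro rfl
        rw [neg_neg] at hi
        exact Fin.succ_ne_zero _ (ha.eq_zero _ hi)
    · rw [zero_add]
      exact sum_ite_le_of_unique _ (fun j k hj hk =>
        Fin.succ_injective _ (ha.inj (neg_injective (hj.symm.trans hk)))) _ hg0 fun _ _ => hg _

end PathKernel

/-- An upper bound for the total weight of the walks with at most `T` steps. -/
def walkBound (A δ : ℝ) (T : ℕ) : ℝ := (T + 1) * A * (1 + δ) ^ T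

lemma walkBound_nonneg {A δ : ℝ} (hA : 0 ≤ A) (hδ : 0 ≤ δ) (T : ℕ) : 0 ≤ walkBound A δ T := by
  unfold walkBound
  positivity

lemma walkBound_succ {A δ : ℝ} (hA : 0 ≤ A) (hδ : 0 ≤ δ) (T : ℕ) :
    A + (1 + δ) * walkBound A δ T ≤ walkBound A δ (T + 1) := by
  have h1 : 1 ≤ (1 + δ) ^ (T + 1) := one_le_pow₀ (by linarith)
  have h2 := mul_le_mul_of_nonneg_left h1 hA
  unfold walkBound
  push_cast
  rw [pow_succ] at *
  nlinarith

lemma walkBound_mono {A δ : ℝ} (hA : 0 ≤ A) (hδ : 0 ≤ δ) : Monotone (walkBound A δ) := by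
  refine monotone_nat_of_le_succ fun T => ?_
  nlinarith [walkBound_succ hA hδ T, mul_nonneg hδ (walkBound_nonneg hA hδ T)]

section WalkBound

variable {V : Type*} [Fintype V] [DecidableEq V] [InvolutiveNeg V] {t : ℕ}
  {L : Finset V} {a : Fin (t + 1) → V}

lemma IsLinkingPath.sum_walkWeight_le (ha : IsLinkingPath L a) {p δ : ℝ} (hp : 0 ≤ p)
    (hδ : 0 ≤ δ) {R : ℕ} (htR : t ≤ R)
    (hpδ : Fintype.card V * p + 2 * R * R * p ≤ 1 + δ) {T : ℕ} (hT : T ≤ R) :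
    (∀ x, ∑ s ∈ Finset.range (T + 1),
        walkWeight (pathKernel p a) (fun x => if -x ∈ L then 1 else 0) s x ≤
          1 + T * (p * walkBound (L.card + 2 * R) δ T)) ∧
      ∑ x, ∑ s ∈ Finset.range (T + 1),
        walkWeight (pathKernel p a) (fun x => if -x ∈ L then 1 else 0) s x ≤
          walkBound (L.card + 2 * R) δ T := by
  set z : V → ℝ := fun x => if -x ∈ L then 1 else 0 with hz
  set A : ℝ := L.card + 2 * R with hA
  have hA0 : 0 ≤ A := by positivity
  have hsumz : ∑ x, z x = L.card := by
    rw [← Equiv.sum_comp (Equiv.neg V)]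
    simp [hz]
  induction T with
  | zero =>
    refine ⟨fun x => ?_, ?_⟩
    · simp only [zero_add, Finset.range_one, Finset.sum_singleton, walkWeight, hz]
      split_ifs <;> simp
    · simp only [zero_add, Finset.range_one, Finset.sum_singleton, walkWeight, hsumz, walkBound]
      simp [hA]
  | succ T ih =>
    obtain ⟨ih1, ih2⟩ := ih (by omega)
    set U : V → ℝ := fun x => ∑ s ∈ Finset.range (T + 1), walkWeight (pathKernel p a) z s x with hU
    set S := walkBound A δ T with hS
    have hS0 : 0 ≤ S := walkBound_nonneg hA0 hδ T
    have hSS : S ≤ walkBound A δ (T + 1) := walkBound_mono hA0 hδ (Nat.le_succ T)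
    have hg1 : 1 ≤ 1 + T * (p * S) := by
      have : 0 ≤ T * (p * S) := by positivity
      linarith
    have hrec : ∀ x, ∑ s ∈ Finset.range (T + 1 + 1), walkWeight (pathKernel p a) z s x =
        z x + (p * ∑ y, U y + pathStep a U x) := by
      intro x
      rw [Finset.sum_range_succ', sum_walkWeight_succ, sum_pathKernel_mul, add_comm]
      rfl
    have hpU : p * ∑ y, U y ≤ p * S := mul_le_mul_of_nonneg_left ih2 hp
    refine ⟨fun x => ?_, ?_⟩
    · rw [hrec]
      have h1 : z x + pathStep a U x ≤ 1 + T * (p * S) := ha.indicator_add_pathStep_le hg1 ih1 x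
      have h2 : ((T + 1 : ℕ) : ℝ) * (p * S) ≤ ((T + 1 : ℕ) : ℝ) * (p * walkBound A δ (T + 1)) := by
        gcongr
      push_cast at h2 ⊢
      linarith
    · simp only [hrec]
      rw [Finset.sum_add_distrib, Finset.sum_add_distrib, hsumz, Finset.sum_const,
        Finset.card_univ, nsmul_eq_mul]
      have h1 : ∑ x, pathStep a U x ≤ 2 * t * (1 + T * (p * S)) := sum_pathStep_le ih1
      have h2 : 2 * t * (1 + T * (p * S)) ≤ 2 * R * (1 + R * (p * S)) := by
        have : (T : ℝ) ≤ R := by exact_mod_cast (by omega : T ≤ R)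
        gcongr
      have h3 : (Fintype.card V : ℝ) * (p * ∑ y, U y) ≤ Fintype.card V * (p * S) := by gcongr
      have h4 := walkBound_succ hA0 hδ T
      have h5 := mul_le_mul_of_nonneg_right hpδ hS0
      rw [← hS] at h4
      nlinarith

lemma IsLinkingPath.sum_mem_walkWeight_le (ha : IsLinkingPath L a) {p δ : ℝ} (hp : 0 ≤ p)
    (hδ : 0 ≤ δ) {R : ℕ} (htR : t ≤ R)
    (hpδ : Fintype.card V * p + 2 * R * R * p ≤ 1 + δ) :
    ∑ s ∈ Finset.range R, ∑ x ∈ L,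
        walkWeight (pathKernel p a) (fun x => if -x ∈ L then 1 else 0) (s + 1) x ≤
      2 + (L.card + 2 * R) * p * walkBound (L.card + 2 * R) δ R := by
  obtain ⟨h1, h2⟩ := ha.sum_walkWeight_le hp hδ htR hpδ le_rfl
  set z : V → ℝ := fun x => if -x ∈ L then 1 else 0 with hz
  have hz0 : ∀ x, 0 ≤ z x := fun x => by simp only [hz]; split_ifs <;> norm_num
  set S := walkBound (L.card + 2 * R) δ R with hS
  have hS0 : 0 ≤ S := walkBound_nonneg (by positivity) hδ R
  have hg0 : 0 ≤ 1 + R * (p * S) := by positivity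
  rw [Finset.sum_comm]
  simp only [sum_walkWeight_succ]
  set U : V → ℝ := fun x => ∑ s ∈ Finset.range R, walkWeight (pathKernel p a) z s x
  have hUle : ∀ x, U x ≤ ∑ s ∈ Finset.range (R + 1), walkWeight (pathKernel p a) z s x := by
    intro x
    rw [Finset.sum_range_succ]
    linarith [walkWeight_nonneg (pathKernel_nonneg hp a) hz0 R x]
  have h3 : ∑ x ∈ L, pathStep a U x ≤ 2 * (1 + R * (p * S)) :=
    ha.sum_mem_pathStep_le hg0 fun x => (hUle x).trans (h1 x)
  have h4 : ∑ y, U y ≤ S := (Finset.sum_le_sum fun x _ => hUle x).trans h2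
  have h5 : (L.card : ℝ) * (p * ∑ y, U y) ≤ L.card * (p * S) := by gcongr
  rw [Finset.sum_congr rfl fun x _ => sum_pathKernel_mul p a U x, Finset.sum_add_distrib,
    Finset.sum_const, nsmul_eq_mul]
  linarith

end WalkBound

section Literals

variable {n : ℕ}

lemma mem_pmSet {x : ℤ} : x ∈ pmSet n ↔ |x| ≤ n ∧ x ≠ 0 := by
  simp [pmSet, abs_le]

instance litInvolutiveNeg (n : ℕ) : InvolutiveNeg (pmSet n) where
  neg x := ⟨-x, by simpa only [mem_pmSet, abs_neg, neg_ne_zero] using x.2⟩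
  neg_neg x := Subtype.ext (neg_neg (x : ℤ))

@[simp] lemma coe_neg_lit (x : pmSet n) : ((-x : pmSet n) : ℤ) = -x := rfl

lemma lit_ne_zero (x : pmSet n) : (x : ℤ) ≠ 0 := (mem_pmSet.1 x.2).2

lemma card_pmSet (n : ℕ) : (pmSet n).card = 2 * n := by
  rw [pmSet, Finset.filter_ne', Finset.card_erase_of_mem (by simp), Int.card_Icc]
  omega

lemma card_clauseSet (n : ℕ) : (clauseSet n).card = 2 * n * (n - 1) := by
  set S := pmSet n ×ˢ pmSet n with hS
  have hswap : (S.filter fun c => |c.2| < |c.1|).card = (clauseSet n).card := by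
    refine Finset.card_bij' (fun c _ => c.swap) (fun c _ => c.swap) ?_ ?_ ?_ ?_ <;>
      simp +contextual [hS, clauseSet]
  have heq : (S.filter fun c => |c.1| = |c.2|).card = 2 * (2 * n) := by
    have : (S.filter fun c => |c.1| = |c.2|) =
        (pmSet n ×ˢ (Finset.univ : Finset Bool)).image
          fun c => (c.1, if c.2 then c.1 else -c.1) := by
      ext ⟨x, y⟩
      simp only [hS, Finset.mem_filter, Finset.mem_product, Finset.mem_image, Finset.mem_univ,
        and_true, Prod.exists, Prod.mk.injEq, Bool.exists_bool, Bool.false_eq_true, if_false,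
        if_true, mem_pmSet]
      constructor
      · rintro ⟨⟨hx, hy⟩, h⟩
        rcases abs_eq_abs.1 h with rfl | rfl
        · exact ⟨x, Or.inr ⟨hx, rfl, rfl⟩⟩
        · exact ⟨-y, Or.inl ⟨hx, rfl, neg_neg y⟩⟩
      · rintro ⟨z, ⟨hz, rfl, rfl⟩ | ⟨hz, rfl, rfl⟩⟩ <;> simp [hz.1, hz.2]
    rw [this, Finset.card_image_of_injOn, Finset.card_product, card_pmSet]
    · simp [mul_comm]
    · rintro ⟨x, b⟩ hx ⟨y, b'⟩ - h
      have hx0 : x ≠ 0 := (mem_pmSet.1 (Finset.mem_product.1 hx).1).2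
      simp only [Prod.mk.injEq] at h
      obtain ⟨rfl, h⟩ := h
      cases b <;> cases b' <;> simp at h ⊢ <;> omega
  have htot : S.card = (2 * n) * (2 * n) := by rw [hS, Finset.card_product, card_pmSet]
  have h1 := Finset.card_filter_add_card_filter_not (s := S) (fun c => |c.1| < |c.2|)
  have h2 := Finset.card_filter_add_card_filter_not
    (s := S.filter fun c => ¬ |c.1| < |c.2|) (fun c => |c.1| = |c.2|)
  have h3 : (S.filter fun c => ¬ |c.1| < |c.2|).filter (fun c => |c.1| = |c.2|) =
      S.filter fun c => |c.1| = |c.2| := by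
    rw [Finset.filter_filter]
    exact Finset.filter_congr fun c _ => ⟨fun h => h.2, fun h => ⟨h.not_lt, h⟩⟩
  have h4 : (S.filter fun c => ¬ |c.1| < |c.2|).filter (fun c => ¬ |c.1| = |c.2|) =
      S.filter fun c => |c.2| < |c.1| := by
    rw [Finset.filter_filter]
    exact Finset.filter_congr fun c _ =>
      ⟨fun h => lt_of_le_of_ne (not_lt.1 h.1) (Ne.symm h.2), fun h => ⟨h.not_gt, h.ne'⟩⟩
  have h0 : (S.filter fun c => |c.1| < |c.2|).card = (clauseSet n).card := rfl
  rw [h3, h4, heq, hswap] at h2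
  rw [h0, htot] at h1
  rcases n with _ | n
  · rw [mul_zero, zero_mul] at h1 ⊢
    omega
  · simp only [Nat.add_sub_cancel]
    nlinarith

/-- The 2-clause expressing the implication `x → y`. -/
def implClause (x y : ℤ) : ℤ × ℤ := if |x| < |y| then (-x, y) else (y, -x)

lemma implClause_mem {x y : ℤ} (hx : x ∈ pmSet n) (hy : y ∈ pmSet n) (h : |x| ≠ |y|) :
    implClause x y ∈ clauseSet n := by
  rw [mem_pmSet] at hx hy
  unfold implClause
  split_ifs with h1
  · simp [clauseSet, mem_pmSet, hx, hy, h1]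
  · simp [clauseSet, mem_pmSet, hx, hy, lt_of_le_of_ne (not_lt.1 h1) h.symm]

lemma implClause_eq {x y x' y' : ℤ} (h : implClause x y = implClause x' y') :
    (x' = x ∧ y' = y) ∨ (x' = -y ∧ y' = -x) := by
  unfold implClause at h
  split_ifs at h <;> simp only [Prod.mk.injEq] at h <;> omega

lemma litEval_neg (x : ℕ → Bool) {l : ℤ} (hl : l ≠ 0) : litEval x (-l) = !litEval x l := by
  unfold litEval
  rcases lt_or_gt_of_ne hl with h | h <;> simp [h, h.not_gt]

lemma litEval_of_implClause {x : ℕ → Bool} {l l' : ℤ} (hl : l ≠ 0)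
    (h : clauseEval x (implClause l l') = true) (hx : litEval x l = true) :
    litEval x l' = true := by
  unfold clauseEval implClause at h
  split_ifs at h <;> simpa [litEval_neg x hl, hx] using h

lemma litEval_fixAssign {L : Finset ℤ} (hL : Consistent n L) (x : ℕ → Bool) {l : ℤ} (hl : l ∈ L) :
    litEval (fixAssign L x) l = true := by
  have hl0 : l ≠ 0 := (mem_pmSet.1 (hL.1 hl)).2
  unfold litEval fixAssign
  rcases lt_or_gt_of_ne hl0 with h | h
  · have h1 : ((l.natAbs : ℕ) : ℤ) = -l := by omega
    simp [h.le, h1, hl, hL.2 l hl]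
  · have h1 : ((l.natAbs : ℕ) : ℤ) = l := by omega
    simp [h, h1, hl]

/-- The implications along the literals `P.2` are the clauses of `φ` with indices `P.1`. -/
def Occurs (φ : Fin n → clauseSet n) {t : ℕ} (P : (Fin t → Fin n) × (Fin (t + 1) → pmSet n)) :
    Prop :=
  ∀ j, (φ (P.1 j) : ℤ × ℤ) = implClause (P.2 j.castSucc) (P.2 j.succ)

lemma not_satFixed_of_occurs {L : Finset ℤ} (hL : Consistent n L) {φ : CNF2 n n} {t : ℕ}
    {P : (Fin t → Fin n) × (Fin (t + 1) → pmSet n)} (h0 : (P.2 0 : ℤ) ∈ L)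
    (h1 : -(P.2 (Fin.last t) : ℤ) ∈ L) (h : Occurs φ P) : ¬ SatFixed L φ := by
  rintro ⟨x, hx⟩
  have key : ∀ i, litEval (fixAssign L x) (P.2 i) = true := by
    intro i
    induction i using Fin.induction with
    | zero => exact litEval_fixAssign hL x h0
    | succ j ih => exact litEval_of_implClause (lit_ne_zero _) (h j ▸ hx (P.1 j)) ih
  have h2 := litEval_fixAssign hL x h1
  rw [litEval_neg _ (lit_ne_zero _), key] at h2
  simp at h2

variable (L : Finset (pmSet n))

open Classical in
/-- The linking paths with `r + 1` clauses, together with the indices of these clauses. -/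
def pathSet (r : ℕ) : Finset ((Fin (r + 1) → Fin n) × (Fin (r + 2) → pmSet n)) :=
  Finset.univ.filter fun P => Function.Injective P.1 ∧ IsLinkingPath L P.2

variable {L}

lemma mem_pathSet {r : ℕ} {P : (Fin (r + 1) → Fin n) × (Fin (r + 2) → pmSet n)} :
    P ∈ pathSet L r ↔ Function.Injective P.1 ∧ IsLinkingPath L P.2 := by
  simp [pathSet]

lemma IsLinkingPath.abs_ne {t : ℕ} {a : Fin (t + 1) → pmSet n} (ha : IsLinkingPath L a)
    (j : Fin t) : |(a j.castSucc : ℤ)| ≠ |(a j.succ : ℤ)| := by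
  intro h
  rcases abs_eq_abs.1 h with h | h
  · have := ha.inj (Subtype.ext h)
    simp [Fin.ext_iff] at this
  · exact ha.ne_neg _ _ (Subtype.ext h)

lemma sum_overlapWeight_implClause_le (C : ℕ) {t : ℕ} (e : Fin t → Fin n)
    (a : Fin (t + 1) → pmSet n) (x y : pmSet n) :
    ∑ i, overlapWeight C e (fun j => implClause (a j.castSucc) (a j.succ)) i (implClause x y) ≤
      pathKernel ((n : ℝ) / C) a x y := by
  refine (sum_overlapWeight_le C e _ _).trans ?_
  rw [Fintype.card_fin, pathKernel]
  refine add_le_add le_rfl (Finset.sum_le_sum fun j _ => ?_)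
  split_ifs with h h1 h2 h3 <;> try norm_num
  rcases implClause_eq h with h' | h'
  · exact h1 ⟨Subtype.ext h'.1, Subtype.ext h'.2⟩
  · exact h3 ⟨Subtype.ext h'.1, Subtype.ext h'.2⟩

lemma sum_pathSet_prod_le (C : ℕ) {t : ℕ} (e : Fin t → Fin n) (a : Fin (t + 1) → pmSet n) (s : ℕ) :
    ∑ Q ∈ pathSet L s, ∏ j, overlapWeight C e (fun j => implClause (a j.castSucc) (a j.succ))
        (Q.1 j) (implClause (Q.2 j.castSucc) (Q.2 j.succ)) ≤
      ∑ x ∈ L, walkWeight (pathKernel ((n : ℝ) / C) a) (fun x => if -x ∈ L then 1 else 0)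
        (s + 1) x := by
  classical
  set w : Fin n → pmSet n → pmSet n → ℝ := fun i x y =>
    overlapWeight C e (fun j => implClause (a j.castSucc) (a j.succ)) i (implClause x y) with hw
  have hw0 : ∀ i x y, 0 ≤ w i x y := fun i x y => overlapWeight_nonneg _ _ _ _ _
  set q : pmSet n → ℝ := fun x => if x ∈ L then 1 else 0 with hq
  have hq0 : ∀ x, 0 ≤ q x := fun x => by simp only [hq]; split_ifs <;> norm_num
  set z : pmSet n → ℝ := fun x => if -x ∈ L then 1 else 0 with hz
  have hz0 : ∀ x, 0 ≤ z x := fun x => by simp only [hz]; split_ifs <;> norm_num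
  calc ∑ Q ∈ pathSet L s, ∏ j, w (Q.1 j) (Q.2 j.castSucc) (Q.2 j.succ)
      = ∑ Q ∈ pathSet L s, q (Q.2 0) * (∏ j, w (Q.1 j) (Q.2 j.castSucc) (Q.2 j.succ)) *
          z (Q.2 (Fin.last _)) := by
        refine Finset.sum_congr rfl fun Q hQ => ?_
        have h := (mem_pathSet.1 hQ).2
        simp [hq, hz, h.head, h.last]
    _ ≤ ∑ Q : (Fin (s + 1) → Fin n) × (Fin (s + 2) → pmSet n),
          q (Q.2 0) * (∏ j, w (Q.1 j) (Q.2 j.castSucc) (Q.2 j.succ)) * z (Q.2 (Fin.last _)) :=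
        Finset.sum_le_sum_of_subset_of_nonneg (Finset.subset_univ _) fun Q _ _ =>
          mul_nonneg (mul_nonneg (hq0 _) (Finset.prod_nonneg fun j _ => hw0 _ _ _)) (hz0 _)
    _ = ∑ b : Fin (s + 2) → pmSet n,
          q (b 0) * (∏ j : Fin (s + 1), ∑ i, w i (b j.castSucc) (b j.succ)) * z (b (Fin.last _)) := by
        rw [Fintype.sum_prod_type, Finset.sum_comm]
        refine Finset.sum_congr rfl fun b _ => ?_
        rw [Finset.prod_univ_sum, Finset.mul_sum, Finset.sum_mul, Fintype.piFinset_univ]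
    _ ≤ ∑ b : Fin (s + 2) → pmSet n,
          q (b 0) * (∏ j : Fin (s + 1), pathKernel ((n : ℝ) / C) a (b j.castSucc) (b j.succ)) *
            z (b (Fin.last _)) := by
        refine Finset.sum_le_sum fun b _ => mul_le_mul_of_nonneg_right
          (mul_le_mul_of_nonneg_left (Finset.prod_le_prod
            (fun j _ => Finset.sum_nonneg fun i _ => hw0 _ _ _) fun j _ =>
              sum_overlapWeight_implClause_le C e a _ _) (hq0 _)) (hz0 _)
    _ = ∑ x ∈ L, walkWeight (pathKernel ((n : ℝ) / C) a) z (s + 1) x := by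
        rw [sum_walks_eq]
        simp only [hq, ite_mul, one_mul, zero_mul, ← Finset.sum_filter, Finset.filter_univ_mem]

end Literals

section Counting

variable {n : ℕ} {L : Finset (pmSet n)}

lemma card_occurs {r : ℕ} {P : (Fin (r + 1) → Fin n) × (Fin (r + 2) → pmSet n)}
    (hP : P ∈ pathSet L r) :
    Nat.card {φ : Fin n → clauseSet n // Occurs φ P} = (clauseSet n).card ^ (n - (r + 1)) := by
  obtain ⟨he, ha⟩ := mem_pathSet.1 hP
  have h := card_prescribed (clauseSet n) he
    (fun j => implClause (P.2 j.castSucc) (P.2 j.succ))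
    fun j => implClause_mem (P.2 _).2 (P.2 _).2 (ha.abs_ne j)
  rwa [Fintype.card_fin] at h

lemma succ_le_of_mem_pathSet {r : ℕ} {P : (Fin (r + 1) → Fin n) × (Fin (r + 2) → pmSet n)}
    (hP : P ∈ pathSet L r) : r + 1 ≤ n := by
  simpa using Fintype.card_le_of_injective _ (mem_pathSet.1 hP).1

lemma sum_card_occurs_pair_le (hn : 2 ≤ n) {R : ℕ} {δ : ℝ} (hδ : 0 ≤ δ)
    (hpδ : ((2 * n : ℕ) : ℝ) * (n / (clauseSet n).card) +
      2 * R * R * (n / (clauseSet n).card) ≤ 1 + δ)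
    {r : ℕ} (hr : r < R) {P : (Fin (r + 1) → Fin n) × (Fin (r + 2) → pmSet n)}
    (hP : P ∈ pathSet L r) :
    ∑ s ∈ Finset.range R, ∑ Q ∈ pathSet L s,
        (Nat.card {φ : Fin n → clauseSet n // Occurs φ P ∧ Occurs φ Q} : ℝ) ≤
      (2 + (L.card + 2 * R) * (n / (clauseSet n).card) * walkBound (L.card + 2 * R) δ R) *
        Nat.card {φ : Fin n → clauseSet n // Occurs φ P} := by
  obtain ⟨he, ha⟩ := mem_pathSet.1 hP
  have hne : (clauseSet n).Nonempty := by
    rw [← Finset.card_pos, card_clauseSet]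
    exact Nat.mul_pos (by omega) (by omega)
  rw [card_occurs hP, mul_comm]
  push_cast
  calc _ ≤ ∑ s ∈ Finset.range R, ∑ Q ∈ pathSet L s, ((clauseSet n).card : ℝ) ^ (n - (r + 1)) *
        ∏ j, overlapWeight (clauseSet n).card P.1
          (fun j => implClause (P.2 j.castSucc) (P.2 j.succ)) (Q.1 j)
          (implClause (Q.2 j.castSucc) (Q.2 j.succ)) := by
        refine Finset.sum_le_sum fun s _ => Finset.sum_le_sum fun Q hQ => ?_
        have h := card_prescribed_pair_le (clauseSet n) hne he
          (fun j => implClause (P.2 j.castSucc) (P.2 j.succ)) (mem_pathSet.1 hQ).1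
          (fun j => implClause (Q.2 j.castSucc) (Q.2 j.succ))
        rwa [Fintype.card_fin] at h
    _ ≤ _ := by
        simp only [← Finset.mul_sum]
        refine mul_le_mul_of_nonneg_left ?_ (by positivity)
        refine (Finset.sum_le_sum fun s _ => sum_pathSet_prod_le _ P.1 P.2 s).trans ?_
        refine ha.sum_mem_walkWeight_le (by positivity) hδ hr ?_
        rwa [Fintype.card_coe, card_pmSet]

lemma sum_card_pathSet_le (hn : 2 ≤ n) {L₀ : Finset ℤ} (hL₀ : Consistent n L₀)
    (hL : ∀ x ∈ L, (x : ℤ) ∈ L₀) {R : ℕ} {δ : ℝ} (hδ : 0 ≤ δ)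
    (hpδ : ((2 * n : ℕ) : ℝ) * (n / (clauseSet n).card) +
      2 * R * R * (n / (clauseSet n).card) ≤ 1 + δ) :
    ∑ r ∈ Finset.range R, ((pathSet L r).card : ℝ) / ((clauseSet n).card : ℝ) ^ (r + 1) ≤
      (2 + (L.card + 2 * R) * (n / (clauseSet n).card) * walkBound (L.card + 2 * R) δ R) *
        (1 - probSatFixed n n L₀) := by
  classical
  set B := 2 + (L.card + 2 * R) * (n / (clauseSet n).card) * walkBound (L.card + 2 * R) δ R with hB
  have hB0 : 0 ≤ B := by
    have := walkBound_nonneg (A := L.card + 2 * R) (by positivity) hδ R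
    positivity
  have hC : 0 < (clauseSet n).card := by
    rw [card_clauseSet]
    exact Nat.mul_pos (by omega) (by omega)
  have h := sum_card_le_mul_card_exists ((Finset.range R).sigma fun r => pathSet L r)
    (fun P (φ : Fin n → clauseSet n) => Occurs φ P.2) B hB0 (by
      rintro ⟨r, P⟩ hP
      rw [Finset.mem_sigma, Finset.mem_range] at hP
      rw [Finset.sum_sigma]
      exact sum_card_occurs_pair_le hn hδ hpδ hP.1 hP.2)
  rw [Finset.sum_sigma] at h
  have hN : (Fintype.card (CNF2 n n) : ℝ) = ((clauseSet n).card : ℝ) ^ n := by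
    have : Fintype.card (CNF2 n n) = Fintype.card (Fin n → clauseSet n) :=
      Fintype.card_congr (Equiv.refl _)
    rw [this]
    simp
  have hN0 : 0 < ((clauseSet n).card : ℝ) ^ n := by positivity
  have hle : (Nat.card {φ : Fin n → clauseSet n //
      ∃ P ∈ (Finset.range R).sigma fun r => pathSet L r, Occurs φ P.2} : ℝ) ≤
      ((clauseSet n).card : ℝ) ^ n * (1 - probSatFixed n n L₀) := by
    rw [probSatFixed, hN, mul_sub, mul_div_cancel₀ _ hN0.ne', mul_one, ← hN]
    have h1 : Nat.card {φ : CNF2 n n // SatFixed L₀ φ} +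
        Nat.card {φ : CNF2 n n // ¬ SatFixed L₀ φ} = Fintype.card (CNF2 n n) := by
      simp only [Nat.card_eq_fintype_card]
      rw [Fintype.card_subtype_compl]
      have := Fintype.card_subtype_le fun φ : CNF2 n n => SatFixed L₀ φ
      omega
    have h2 : Nat.card {φ : Fin n → clauseSet n //
        ∃ P ∈ (Finset.range R).sigma fun r => pathSet L r, Occurs φ P.2} ≤
        Nat.card {φ : CNF2 n n // ¬ SatFixed L₀ φ} := by
      refine Nat.card_le_card_of_injective
        (fun φ => ⟨φ.1, ?_⟩) fun φ ψ h => Subtype.ext (Subtype.mk.inj h)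
      obtain ⟨φ, ⟨r, P⟩, hP, hφ⟩ := φ
      have ha := (mem_pathSet.1 (Finset.mem_sigma.1 hP).2).2
      exact not_satFixed_of_occurs hL₀ (hL _ ha.head) (hL _ ha.last) hφ
    have h3 : (Nat.card {φ : Fin n → clauseSet n //
        ∃ P ∈ (Finset.range R).sigma fun r => pathSet L r, Occurs φ P.2} : ℝ) ≤
        Nat.card {φ : CNF2 n n // ¬ SatFixed L₀ φ} := by exact_mod_cast h2
    have h4 : (Nat.card {φ : CNF2 n n // SatFixed L₀ φ} : ℝ) +
        Nat.card {φ : CNF2 n n // ¬ SatFixed L₀ φ} = Fintype.card (CNF2 n n) := by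
      exact_mod_cast h1
    linarith
  refine le_of_mul_le_mul_left ?_ hN0
  calc _ = ∑ r ∈ Finset.range R, ∑ P ∈ pathSet L r,
        (Nat.card {φ : Fin n → clauseSet n // Occurs φ P} : ℝ) := by
        rw [Finset.mul_sum]
        refine Finset.sum_congr rfl fun r _ => ?_
        rw [Finset.sum_congr rfl fun P hP => by rw [card_occurs hP], Finset.sum_const, nsmul_eq_mul]
        rcases (pathSet L r).eq_empty_or_nonempty with h0 | ⟨P, hP⟩
        · simp [h0]
        · rw [mul_div_assoc', div_eq_iff (by positivity)]
          push_cast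
          rw [mul_assoc, ← pow_add, Nat.sub_add_cancel (succ_le_of_mem_pathSet hP), mul_comm]
    _ ≤ _ := h.trans ((mul_le_mul_of_nonneg_left hle hB0).trans (le_of_eq (by ring)))

lemma isLinkingPath_cons_snoc {x y : pmSet n} (hL : ∀ l ∈ L, -l ∉ L) (hx : x ∈ L) (hy : y ∈ L)
    (hxy : x ≠ y) {r : ℕ} {m : Fin r → pmSet n} (hm : Function.Injective m)
    (hm' : ∀ i j, m i ≠ -m j) (hmL : ∀ i, m i ∉ L ∧ -m i ∉ L) :
    IsLinkingPath L (Fin.cons x (Fin.snoc m (-y) : Fin (r + 1) → pmSet n) : Fin (r + 2) → pmSet n)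
    where
  inj := by
    rw [Fin.cons_injective_iff, Fin.snoc_injective_iff]
    refine ⟨?_, hm, ?_⟩
    · rintro ⟨i, hi⟩
      induction i using Fin.lastCases with
      | last => rw [Fin.snoc_last] at hi; exact hL y hy (hi ▸ hx)
      | cast i => rw [Fin.snoc_castSucc] at hi; exact (hmL i).1 (hi ▸ hx)
    · rintro ⟨i, hi⟩
      exact (hmL i).2 (by rwa [hi, neg_neg])
  ne_neg := by
    intro i j h
    induction i using Fin.cases with
    | zero =>
      induction j using Fin.cases with
      | zero => exact hL x hx (by simpa using h ▸ hx)
      | succ j =>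
        induction j using Fin.lastCases with
        | last => simp only [Fin.cons_zero, Fin.cons_succ, Fin.snoc_last, neg_neg] at h; exact hxy h
        | cast j =>
          simp only [Fin.cons_zero, Fin.cons_succ, Fin.snoc_castSucc] at h
          exact (hmL j).2 (h ▸ hx)
    | succ i =>
      induction i using Fin.lastCases with
      | last =>
        induction j using Fin.cases with
        | zero =>
          simp only [Fin.cons_zero, Fin.cons_succ, Fin.snoc_last, neg_inj] at h
          exact hxy h.symm
        | succ j =>
          induction j using Fin.lastCases with
          | last =>
            simp only [Fin.cons_succ, Fin.snoc_last, neg_neg] at h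
            exact hL y hy (h.symm ▸ hy)
          | cast j =>
            simp only [Fin.cons_succ, Fin.snoc_last, Fin.snoc_castSucc, neg_inj] at h
            exact (hmL j).1 (h ▸ hy)
      | cast i =>
        induction j using Fin.cases with
        | zero =>
          simp only [Fin.cons_zero, Fin.cons_succ, Fin.snoc_castSucc] at h
          exact (hmL i).2 (by rwa [h, neg_neg])
        | succ j =>
          induction j using Fin.lastCases with
          | last =>
            simp only [Fin.cons_succ, Fin.snoc_last, Fin.snoc_castSucc, neg_neg] at h
            exact (hmL i).1 (h ▸ hy)
          | cast j =>
            simp only [Fin.cons_succ, Fin.snoc_castSucc] at h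
            exact hm' i j h
  head := hx
  last := by
    rw [← Fin.succ_last, Fin.cons_succ, Fin.snoc_last, neg_neg]
    exact hy
  eq_zero := by
    intro i hi
    induction i using Fin.cases with
    | zero => rfl
    | succ i =>
      rw [Fin.cons_succ] at hi
      induction i using Fin.lastCases with
      | last => rw [Fin.snoc_last] at hi; exact absurd hi (hL y hy)
      | cast i => rw [Fin.snoc_castSucc] at hi; exact absurd hi (hmL i).1
  eq_last := by
    intro i hi
    induction i using Fin.cases with
    | zero => exact absurd hi (hL x hx)
    | succ i =>
      rw [Fin.cons_succ] at hi
      induction i using Fin.lastCases with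
      | last => rfl
      | cast i => rw [Fin.snoc_castSucc] at hi; exact absurd hi (hmL i).2

variable (L) in
/-- The positive literals whose variables do not occur in `L`. -/
def freeVars : Finset (pmSet n) :=
  Finset.univ.filter fun x => 0 < (x : ℤ) ∧ x ∉ L ∧ -x ∉ L

lemma sub_card_le_card_freeVars : n - L.card ≤ (freeVars L).card := by
  have h1 : (Finset.univ.filter fun x : pmSet n => 0 < (x : ℤ)).card = n := by
    rw [← Finset.card_map (Function.Embedding.subtype _)]
    have : (Finset.univ.filter fun x : pmSet n => 0 < (x : ℤ)).map
        (Function.Embedding.subtype _) = Finset.Icc 1 (n : ℤ) := by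
      ext x
      simp only [Finset.mem_map, Finset.mem_filter, Finset.mem_univ, true_and,
        Function.Embedding.subtype_apply, Subtype.exists, exists_and_left, exists_prop,
        Finset.mem_Icc, mem_pmSet]
      constructor
      · rintro ⟨y, hy, ⟨hy', -⟩, rfl⟩
        rw [abs_of_pos hy] at hy'
        omega
      · rintro ⟨h1, h2⟩
        exact ⟨x, by omega, ⟨by rw [abs_of_pos (by omega)]; exact h2, by omega⟩, rfl⟩
    rw [this, Int.card_Icc]
    omega
  have h2 : (Finset.univ.filter fun x : pmSet n => 0 < (x : ℤ)) ⊆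
      freeVars L ∪ L.image fun x : pmSet n => if 0 < (x : ℤ) then x else -x := by
    intro x hx
    have hx0 : 0 < (x : ℤ) := (Finset.mem_filter.1 hx).2
    rw [Finset.mem_union, Finset.mem_image]
    by_cases h3 : x ∈ L
    · exact Or.inr ⟨x, h3, if_pos hx0⟩
    by_cases h4 : -x ∈ L
    · refine Or.inr ⟨-x, h4, ?_⟩
      rw [if_neg (by rw [coe_neg_lit]; omega), neg_neg]
    · exact Or.inl (Finset.mem_filter.2 ⟨Finset.mem_univ _, hx0, h3, h4⟩)
  have h3 := (Finset.card_le_card h2).trans (Finset.card_union_le _ _)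
  have h4 := Finset.card_image_le (s := L) (f := fun x : pmSet n => if 0 < (x : ℤ) then x else -x)
  omega

lemma le_card_pathSet (hL : ∀ l ∈ L, -l ∉ L) (r : ℕ) :
    n.descFactorial (r + 1) * (L.card * L.card - L.card) *
      (2 ^ r * (n - L.card).descFactorial r) ≤ (pathSet L r).card := by
  classical
  let m : (Fin r ↪ freeVars L) × (Fin r → Bool) → Fin r → pmSet n :=
    fun v j => if v.2 j then (v.1 j : pmSet n) else -(v.1 j : pmSet n)
  let F : ((Fin (r + 1) ↪ Fin n) × L.offDiag) × ((Fin r ↪ freeVars L) × (Fin r → Bool)) →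
      (Fin (r + 1) → Fin n) × (Fin (r + 2) → pmSet n) :=
    fun w => (w.1.1, Fin.cons w.1.2.1.1 (Fin.snoc (m w.2) (-w.1.2.1.2) : Fin (r + 1) → pmSet n))
  have hpos : ∀ (v : (Fin r ↪ freeVars L) × (Fin r → Bool)) j, 0 < ((v.1 j : pmSet n) : ℤ) :=
    fun v j => (Finset.mem_filter.1 (v.1 j).2).2.1
  have habs : ∀ v j, |(m v j : ℤ)| = ((v.1 j : pmSet n) : ℤ) := by
    intro v j
    simp only [m]
    split_ifs <;> simp [(hpos v j).le]
  have hv : ∀ (v : (Fin r ↪ freeVars L) × (Fin r → Bool)) i j,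
      ((v.1 i : pmSet n) : ℤ) = ((v.1 j : pmSet n) : ℤ) → i = j :=
    fun v i j h => v.1.injective (Subtype.ext (Subtype.ext h))
  have hm : ∀ v, Function.Injective (m v) := fun v i j h => by
    refine hv v i j ?_
    rw [← habs, ← habs, h]
  have hm' : ∀ v i j, m v i ≠ -m v j := by
    intro v i j h
    have hij : i = j := by
      refine hv v i j ?_
      rw [← habs, ← habs, h, coe_neg_lit, abs_neg]
    subst hij
    have h1 := congrArg (Subtype.val) h
    have h2 := lit_ne_zero (m v i)
    rw [coe_neg_lit] at h1
    omega
  have hmL : ∀ v i, m v i ∉ L ∧ -m v i ∉ L := by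
    intro v i
    have h := (Finset.mem_filter.1 (v.1 i).2).2.2
    simp only [m]
    split_ifs
    · exact h
    · rw [neg_neg]; exact h.symm
  have hF : ∀ w, F w ∈ pathSet L r := fun w => by
    have h := Finset.mem_offDiag.1 w.1.2.2
    exact mem_pathSet.2 ⟨w.1.1.injective,
      isLinkingPath_cons_snoc hL h.1 h.2.1 h.2.2 (hm _) (hm' _) (hmL _)⟩
  have hFinj : Function.Injective F := by
    rintro ⟨⟨e, ⟨⟨x, y⟩, hxy⟩⟩, v⟩ ⟨⟨e', ⟨⟨x', y'⟩, hxy'⟩⟩, v'⟩ h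
    simp only [F, Prod.mk.injEq, Fin.cons_inj, Fin.snoc_inj, neg_inj, DFunLike.coe_fn_eq] at h
    obtain ⟨rfl, rfl, hmm, rfl⟩ := h
    have h1 : v.1 = v'.1 := by
      ext j
      rw [← habs, ← habs, hmm]
    have h2 : v.2 = v'.2 := by
      funext j
      have h3 := congrArg Subtype.val (congrFun hmm j)
      have h4 := hpos v j
      simp only [m, ← h1] at h3
      split_ifs at h3 with h5 h6 h6 <;> simp only [coe_neg_lit] at h3 <;>
        first | omega | simp_all
    rw [Prod.ext h1 h2]
  have hcard := Finset.card_le_card_of_injOn F (s := Finset.univ) (fun w _ => hF w) hFinj.injOn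
  rw [Finset.card_univ, Fintype.card_prod, Fintype.card_prod, Fintype.card_prod,
    Fintype.card_embedding_eq, Fintype.card_embedding_eq, Fintype.card_coe, Fintype.card_coe,
    Finset.offDiag_card, Fintype.card_fun, Fintype.card_bool, Fintype.card_fin, Fintype.card_fin,
    Fintype.card_fin] at hcard
  refine le_trans ?_ hcard
  rw [mul_comm (2 ^ r)]
  gcongr
  exact sub_card_le_card_freeVars

end Counting

lemma one_sub_mul_le_pow {x : ℝ} (hx0 : 0 ≤ x) (hx1 : x ≤ 1) {r R : ℕ} (hr : r ≤ R) :
    1 - R * x ≤ (1 - x) ^ r := by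
  have h := one_add_mul_le_pow (a := -x) (by linarith) R
  calc 1 - R * x ≤ (1 + -x) ^ R := by linarith
    _ = (1 - x) ^ R := by rw [← sub_eq_add_neg]
    _ ≤ (1 - x) ^ r := pow_le_pow_of_le_one (by linarith) (by linarith) hr

lemma le_sum_card_pathSet_div {n : ℕ} (hn : 2 ≤ n) {L : Finset (pmSet n)} (hL : ∀ l ∈ L, -l ∉ L)
    {R : ℕ} (hR : L.card + R ≤ n) (hq : (R : ℝ) * ((L.card + R) / n) ≤ 1) :
    R * (n / (clauseSet n).card) * (L.card * L.card - L.card) *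
        ((1 - R * (R / n)) * (1 - R * ((L.card + R) / n))) ≤
      ∑ r ∈ Finset.range R, ((pathSet L r).card : ℝ) / ((clauseSet n).card : ℝ) ^ (r + 1) := by
  set k := L.card with hk
  have hn0 : (0 : ℝ) < n := by exact_mod_cast (by omega : 0 < n)
  have hn1 : (0 : ℝ) < (n - 1 : ℕ) := by exact_mod_cast (by omega : 0 < n - 1)
  have hn1' : ((n - 1 : ℕ) : ℝ) ≤ n := by exact_mod_cast Nat.sub_le n 1
  have hkk : (0 : ℝ) ≤ k * k - k := by
    have : k ≤ k * k := Nat.le_mul_self k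
    have : (k : ℝ) ≤ k * k := by exact_mod_cast this
    linarith
  have hRn : (R : ℝ) / n ≤ 1 := by
    rw [div_le_one hn0]
    exact_mod_cast (by omega : R ≤ n)
  have hkRn : ((k : ℝ) + R) / n ≤ 1 := by
    rw [div_le_one hn0]
    exact_mod_cast hR
  have hC : ((clauseSet n).card : ℝ) = 2 * n * (n - 1 : ℕ) := by
    rw [card_clauseSet]
    push_cast
    ring
  have hterm : ∀ r ∈ Finset.range R, (n / (clauseSet n).card : ℝ) * (k * k - k) *
      ((1 - R * (R / n)) * (1 - R * ((k + R) / n))) ≤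
      ((pathSet L r).card : ℝ) / ((clauseSet n).card : ℝ) ^ (r + 1) := by
    intro r hr
    rw [Finset.mem_range] at hr
    have h1 : ((n - r : ℕ) : ℝ) ^ (r + 1) * (k * k - k) * (2 ^ r * ((n - k - r : ℕ) : ℝ) ^ r) ≤
        ((pathSet L r).card : ℝ) := by
      have h2 := le_card_pathSet hL r
      have h3 : (n - r) ^ (r + 1) ≤ n.descFactorial (r + 1) := by
        simpa using Nat.pow_sub_le_descFactorial n (r + 1)
      have h4 : (n - k - r) ^ r ≤ (n - k).descFactorial r :=
        (Nat.pow_le_pow_left (by omega) r).trans (Nat.pow_sub_le_descFactorial (n - k) r)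
      have h5 : (n - r) ^ (r + 1) * (k * k - k) * (2 ^ r * (n - k - r) ^ r) ≤
          (pathSet L r).card := le_trans (by gcongr) h2
      have h6 : (((k * k - k : ℕ)) : ℝ) = k * k - k := by
        rw [Nat.cast_sub (Nat.le_mul_self k)]
        push_cast
        ring
      have h7 := (Nat.cast_le (α := ℝ)).2 h5
      push_cast [h6] at h7
      exact h7
    have h2 : 1 - R * ((R : ℝ) / n) ≤ (((n - r : ℕ) : ℝ) / n) ^ (r + 1) := by
      refine (one_sub_mul_le_pow (by positivity) hRn hr).trans ?_
      refine pow_le_pow_left₀ (by linarith) ?_ _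
      rw [le_div_iff₀ hn0, sub_mul, div_mul_cancel₀ _ hn0.ne', Nat.cast_sub (by omega)]
      have : (r : ℝ) ≤ R := by exact_mod_cast hr.le
      linarith
    have h3 : 1 - R * (((k : ℝ) + R) / n) ≤ (((n - k - r : ℕ) : ℝ) / (n - 1 : ℕ)) ^ r := by
      refine (one_sub_mul_le_pow (by positivity) hkRn hr.le).trans ?_
      refine pow_le_pow_left₀ (by linarith) ?_ _
      refine le_trans ?_ (div_le_div_of_nonneg_left (by positivity) hn1 hn1')
      rw [le_div_iff₀ hn0, sub_mul, div_mul_cancel₀ _ hn0.ne', Nat.sub_sub,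
        Nat.cast_sub (by omega)]
      have : (r : ℝ) ≤ R := by exact_mod_cast hr.le
      push_cast
      linarith
    refine le_trans ?_ (div_le_div_of_nonneg_right h1 (by positivity))
    have h4 : ((n - r : ℕ) : ℝ) ^ (r + 1) * (k * k - k) * (2 ^ r * ((n - k - r : ℕ) : ℝ) ^ r) /
        ((clauseSet n).card : ℝ) ^ (r + 1) = (n / (clauseSet n).card : ℝ) * (k * k - k) *
        ((((n - r : ℕ) : ℝ) / n) ^ (r + 1) * (((n - k - r : ℕ) : ℝ) / (n - 1 : ℕ)) ^ r) := by
      rw [hC, div_pow, div_pow, mul_pow, mul_pow, pow_succ 2, pow_succ ((n - 1 : ℕ) : ℝ)]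
      field_simp
    rw [h4]
    refine mul_le_mul_of_nonneg_left ?_ (mul_nonneg (by positivity) hkk)
    exact mul_le_mul h2 h3 (by linarith) (by positivity)
  have h := Finset.sum_le_sum hterm
  rw [Finset.sum_const, Finset.card_range, nsmul_eq_mul] at h
  exact le_trans (le_of_eq (by ring)) h

lemma exists_literals_card_eq {n : ℕ} {L : Finset ℤ} (hL : Consistent n L) {k : ℕ}
    (hk : k ≤ L.card) : ∃ L' : Finset (pmSet n), (∀ x ∈ L', (x : ℤ) ∈ L) ∧ L'.card = k := by
  have h : (L.subtype (· ∈ pmSet n)).card = L.card := by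
    rw [Finset.card_subtype, Finset.filter_true_of_mem fun x hx => hL.1 hx]
  obtain ⟨L', hL', hcard⟩ := Finset.exists_subset_card_eq (h ▸ hk)
  exact ⟨L', fun x hx => Finset.mem_subtype.1 (hL' hx), hcard⟩

lemma probSatFixed_nonneg (n m : ℕ) (L : Finset ℤ) : 0 ≤ probSatFixed n m L := by
  unfold probSatFixed
  positivity

lemma probSatFixed_le_one (n m : ℕ) (L : Finset ℤ) : probSatFixed n m L ≤ 1 := by
  refine div_le_one_of_le₀ ?_ (by positivity)
  rw [← Nat.card_eq_fintype_card]
  exact_mod_cast Finite.card_subtype_le _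

lemma probSatFixed_le {n k R : ℕ} (hn : 2 ≤ n) {L : Finset ℤ} (hL : Consistent n L)
    (hk0 : 0 < k) (hk : k ≤ L.card) (hR0 : 0 < R) (hkR : k + R ≤ n)
    (hq : (R : ℝ) * ((k + R) / n) ≤ 1) :
    probSatFixed n n L ≤ 1 - (1 - 1 / k) * ((1 - R * (R / n)) * (1 - R * ((k + R) / n))) /
      (4 * (n / (R * (k * k))) + (1 + 2 * (R / k)) ^ 2 * (1 + 1 / R) *
        (1 + 2 * (1 + R * R) / n) ^ R) := by
  obtain ⟨L', hL'L, rfl⟩ := exists_literals_card_eq hL hk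
  have hL' : ∀ l ∈ L', -l ∉ L' := fun l hl hl' => hL.2 l (hL'L l hl) (hL'L _ hl')
  have hn1 : (2 : ℝ) ≤ n := by exact_mod_cast hn
  have hC : ((clauseSet n).card : ℝ) = 2 * n * (n - 1) := by
    rw [card_clauseSet]
    push_cast [Nat.cast_sub (by omega : 1 ≤ n)]
    ring
  set δ : ℝ := 2 * (1 + R * R) / n with hδ
  have hδ0 : 0 ≤ δ := by positivity
  set p : ℝ := n / (clauseSet n).card with hp
  have hp' : p = 1 / (2 * (n - 1)) := by
    rw [hp, hC]
    have : (n : ℝ) - 1 ≠ 0 := by linarith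
    field_simp
  have hp0 : 0 < p := by
    rw [hp']
    have : (0 : ℝ) < n - 1 := by linarith
    positivity
  have hpδ : ((2 * n : ℕ) : ℝ) * p + 2 * R * R * p ≤ 1 + δ := by
    have h0 : (0 : ℝ) < n - 1 := by linarith
    have h1 : ((2 * n : ℕ) : ℝ) * p + 2 * R * R * p = 1 + (1 + R * R) / (n - 1) := by
      rw [hp']
      push_cast
      field_simp
      ring
    have h2 : (1 + (R : ℝ) * R) / (n - 1) ≤ δ := by
      rw [hδ, div_le_div_iff₀ h0 (by linarith)]
      nlinarith [mul_nonneg (by positivity : (0 : ℝ) ≤ 1 + R * R) (by linarith : (0 : ℝ) ≤ n - 2)]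
    linarith
  have hupper := sum_card_pathSet_le hn hL hL'L hδ0 hpδ
  have hlower := le_sum_card_pathSet_div hn hL' hkR hq
  have hmain := hlower.trans hupper
  rw [← hp] at hmain
  set q : ℝ := (1 - R * (R / n)) * (1 - R * ((L'.card + R) / n))
  have hk1 : (0 : ℝ) < L'.card := by exact_mod_cast hk0
  have hR1 : (0 : ℝ) < R := by exact_mod_cast hR0
  set e : ℝ := (1 + δ) ^ R with he
  have he0 : 0 < e := by positivity
  set D : ℝ := 4 * (n / (R * (L'.card * L'.card))) +
    (1 + 2 * (R / L'.card)) ^ 2 * (1 + 1 / R) * e with hD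
  have hD0 : 0 < D := by positivity
  have hB : 2 + (L'.card + 2 * R) * p * walkBound (L'.card + 2 * R) δ R ≤
      (R * p * (L'.card * L'.card)) * D := by
    have h1 : (R * p * (L'.card * L'.card)) * D =
        4 * (n * p) + (L'.card + 2 * R) * p * walkBound (L'.card + 2 * R) δ R := by
      rw [hD, walkBound, ← he]
      field_simp
    have h2 : 1 / 2 ≤ n * p := by
      rw [hp', mul_one_div, div_le_div_iff₀ (by norm_num) (by linarith)]
      linarith
    linarith
  have hP : 0 ≤ 1 - probSatFixed n n L := sub_nonneg.2 (probSatFixed_le_one n n L)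
  have h3 := hmain.trans (mul_le_mul_of_nonneg_right hB hP)
  have h4 : (R * p * (L'.card * L'.card)) * ((1 - 1 / L'.card) * q) ≤
      (R * p * (L'.card * L'.card)) * (D * (1 - probSatFixed n n L)) := by
    refine le_trans (le_of_eq ?_) (h3.trans (le_of_eq (mul_assoc _ _ _)))
    field_simp
  have h5 := le_of_mul_le_mul_left h4 (by positivity)
  have h6 : (1 - 1 / L'.card) * q / D ≤ 1 - probSatFixed n n L := by
    rwa [div_le_iff₀ hD0, mul_comm (1 - probSatFixed n n L)]
  linarith

lemma tendsto_natCast_rpow_neg {γ : ℝ} (hγ : γ < 0) :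
    Tendsto (fun n : ℕ => (n : ℝ) ^ γ) atTop (𝓝 0) := by
  have h := (tendsto_rpow_neg_atTop (neg_pos.2 hγ)).comp tendsto_natCast_atTop_atTop
  simpa [Function.comp_def] using h

lemma tendsto_floor_const_mul_rpow_div {c γ : ℝ} (hc : 0 < c) (hγ : 0 < γ) :
    Tendsto (fun n : ℕ => (⌊c * (n : ℝ) ^ γ⌋₊ : ℝ) / (n : ℝ) ^ γ) atTop (𝓝 c) :=
  (tendsto_nat_floor_mul_div_atTop hc.le).comp
    ((tendsto_rpow_atTop hγ).comp tendsto_natCast_atTop_atTop)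

lemma tendsto_one_add_div_pow {R : ℕ → ℕ}
    (h1 : Tendsto (fun n => (R n : ℝ) / n) atTop (𝓝 0))
    (h3 : Tendsto (fun n => (R n : ℝ) * (R n * R n) / n) atTop (𝓝 0)) :
    Tendsto (fun n => (1 + 2 * (1 + (R n : ℝ) * R n) / n) ^ R n) atTop (𝓝 1) := by
  have h : Tendsto (fun n => Real.exp (2 * ((R n : ℝ) / n + R n * (R n * R n) / n)))
      atTop (𝓝 1) := by
    have := (Real.continuous_exp.tendsto _).comp ((h1.add h3).const_mul 2)
    simpa [Function.comp_def] using this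
  refine tendsto_of_tendsto_of_tendsto_of_le_of_le tendsto_const_nhds h (fun n => ?_) fun n => ?_
  · refine one_le_pow₀ ?_
    have : 0 ≤ 2 * (1 + (R n : ℝ) * R n) / n := by positivity
    linarith
  · have h0 : 0 ≤ 2 * (1 + (R n : ℝ) * R n) / n := by positivity
    calc (1 + 2 * (1 + (R n : ℝ) * R n) / n) ^ R n
        ≤ Real.exp (2 * (1 + (R n : ℝ) * R n) / n) ^ R n := by
          refine pow_le_pow_left₀ (by linarith) ?_ _
          rw [add_comm]
          exact Real.add_one_le_exp _
      _ = Real.exp (2 * ((R n : ℝ) / n + R n * (R n * R n) / n)) := by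
          rw [← Real.exp_nat_mul]
          congr 1
          ring

/-- Convergence to zero from the asymptotic relations between the number `k` of fixed variables that
are used and the maximal length `R` of the linking paths that are counted. -/
theorem probSatFixed_tendsto_zero {k R : ℕ → ℕ} (L : (n : ℕ) → Finset ℤ)
    (hL : ∀ n, Consistent n (L n)) (hk : ∀ᶠ n in atTop, k n ≤ (L n).card)
    (hkinf : Tendsto (fun n => 1 / (k n : ℝ)) atTop (𝓝 0)) (hk0 : ∀ᶠ n in atTop, 0 < k n)
    (hRinf : Tendsto (fun n => 1 / (R n : ℝ)) atTop (𝓝 0)) (hR0 : ∀ᶠ n in atTop, 0 < R n)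
    (hRk : Tendsto (fun n => (R n : ℝ) / k n) atTop (𝓝 0))
    (hkn : Tendsto (fun n => (k n : ℝ) / n) atTop (𝓝 0))
    (hRkn : Tendsto (fun n => (R n : ℝ) * (k n / n)) atTop (𝓝 0))
    (hR3 : Tendsto (fun n => (R n : ℝ) * (R n * R n) / n) atTop (𝓝 0))
    (hRkk : Tendsto (fun n : ℕ => (n : ℝ) / (R n * (k n * k n))) atTop (𝓝 0)) :
    Tendsto (fun n => probSatFixed n n (L n)) atTop (𝓝 0) := by
  have hRn : Tendsto (fun n => (R n : ℝ) / n) atTop (𝓝 0) := by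
    have h := hRk.mul hkn
    rw [mul_zero] at h
    refine h.congr' ?_
    filter_upwards [hk0] with n hn
    have : (k n : ℝ) ≠ 0 := by exact_mod_cast hn.ne'
    field_simp
  have hRRn : Tendsto (fun n => (R n : ℝ) * (R n / n)) atTop (𝓝 0) := by
    have h := hR3.mul hRinf
    rw [mul_zero] at h
    refine h.congr' ?_
    filter_upwards [hR0] with n hn
    have : (R n : ℝ) ≠ 0 := by exact_mod_cast hn.ne'
    field_simp
  have hRkRn : Tendsto (fun n => (R n : ℝ) * ((k n + R n) / n)) atTop (𝓝 0) := by
    have h := hRkn.add hRRn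
    rw [add_zero] at h
    refine h.congr fun n => ?_
    ring
  have hlim : Tendsto (fun n : ℕ => 1 - (1 - 1 / (k n : ℝ)) *
      ((1 - R n * ((R n : ℝ) / n)) * (1 - R n * ((k n + R n) / n))) /
      (4 * ((n : ℝ) / (R n * (k n * k n))) + (1 + 2 * ((R n : ℝ) / k n)) ^ 2 * (1 + 1 / R n) *
        (1 + 2 * (1 + (R n : ℝ) * R n) / n) ^ R n)) atTop (𝓝 0) := by
    have h1 := (hkinf.const_sub 1).mul ((hRRn.const_sub 1).mul (hRkRn.const_sub 1))
    have h2 := (hRkk.const_mul 4).add (((((hRk.const_mul 2).const_add 1).pow 2).mul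
      (hRinf.const_add 1)).mul (tendsto_one_add_div_pow hRn hR3))
    have h3 := (h1.div h2 (by norm_num)).const_sub 1
    convert h3 using 2
    all_goals norm_num
  refine tendsto_of_tendsto_of_tendsto_of_le_of_le' tendsto_const_nhds hlim
    (Eventually.of_forall fun n => probSatFixed_nonneg _ _ _) ?_
  have hkRn : Tendsto (fun n => (k n : ℝ) / n + R n / n) atTop (𝓝 0) := by
    simpa using hkn.add hRn
  filter_upwards [hk, hk0, hR0, hkRn.eventually (eventually_le_nhds zero_lt_one),
    hRkRn.eventually (eventually_le_nhds zero_lt_one), eventually_ge_atTop 2]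
    with n h1 h2 h3 h4 h5 h6
  refine probSatFixed_le h6 (hL n) h2 h1 h3 ?_ h5
  have hn0 : (0 : ℝ) < n := by exact_mod_cast (by omega : 0 < n)
  rw [← add_div, div_le_one hn0] at h4
  exact_mod_cast h4

/-- if `f(n) ≥ c n^{1/3+ε}` eventually, then fixing any consistent family of
literal sets of size `f(n)` in `Φₙ ~ F₂(n,n)` makes the probability of satisfiability tend to 0. -/
theorem statement0 (ε : ℝ) (hε : 0 < ε)
    (f : ℕ → ℕ) (hfn : ∀ n, f n ≤ n)
    (hgrowth : ∃ c : ℝ, 0 < c ∧ ∀ᶠ n : ℕ in atTop, c * (n : ℝ) ^ ((1 : ℝ) / 3 + ε) ≤ (f n : ℝ))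
    (L : (n : ℕ) → Finset ℤ)
    (hLcons : ∀ n, Consistent n (L n)) (hLcard : ∀ n, (L n).card = f n) :
    Tendsto (fun n => probSatFixed n n (L n)) atTop (𝓝 0) := by
  obtain ⟨c, hc, hf⟩ := hgrowth
  obtain ⟨η, hη⟩ : ∃ η, η = min ε (1 / 10) := ⟨_, rfl⟩
  have hη0 : 0 < η := hη ▸ lt_min hε (by norm_num)
  have hη1 : η ≤ 1 / 10 := hη ▸ min_le_right _ _
  obtain ⟨α, hα⟩ : ∃ α, α = 1 / 3 + η := ⟨_, rfl⟩
  obtain ⟨β, hβ⟩ : ∃ β, β = 1 / 3 - η := ⟨_, rfl⟩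
  set k : ℕ → ℕ := fun n => ⌊c * (n : ℝ) ^ α⌋₊ with hk
  set R : ℕ → ℕ := fun n => ⌊1 * (n : ℝ) ^ β⌋₊ with hR
  have hκ : Tendsto (fun n : ℕ => (k n : ℝ) / (n : ℝ) ^ α) atTop (𝓝 c) :=
    tendsto_floor_const_mul_rpow_div hc (by linarith)
  have hρ : Tendsto (fun n : ℕ => (R n : ℝ) / (n : ℝ) ^ β) atTop (𝓝 1) :=
    tendsto_floor_const_mul_rpow_div one_pos (by linarith)
  have hk0 : ∀ᶠ n in atTop, 0 < k n := by
    filter_upwards [hκ.eventually (eventually_gt_nhds hc)] with n hn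
    by_contra h
    simp [Nat.eq_zero_of_not_pos h] at hn
  have hR0 : ∀ᶠ n in atTop, 0 < R n := by
    filter_upwards [hρ.eventually (eventually_gt_nhds one_pos)] with n hn
    by_contra h
    simp [Nat.eq_zero_of_not_pos h] at hn
  have key : ∀ {γ l : ℝ} {g h : ℕ → ℝ}, γ < 0 → Tendsto g atTop (𝓝 l) →
      (∀ᶠ n : ℕ in atTop, 0 < (n : ℝ) → g n * (n : ℝ) ^ γ = h n) → Tendsto h atTop (𝓝 0) := by
    intro γ l g h hγ hg hgh
    have h1 := hg.mul (tendsto_natCast_rpow_neg hγ)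
    rw [mul_zero] at h1
    refine h1.congr' ?_
    filter_upwards [hgh, eventually_gt_atTop 0] with n hn hn0
    exact hn (by exact_mod_cast hn0)
  have hκi := hκ.inv₀ hc.ne'
  have hρi := hρ.inv₀ one_ne_zero
  refine probSatFixed_tendsto_zero (k := k) (R := R) L hLcons ?_ ?_ hk0 ?_ hR0 ?_ ?_ ?_ ?_ ?_
  · filter_upwards [hf, eventually_ge_atTop 1] with n hn hn1
    rw [hLcard]
    refine Nat.floor_le_of_le (le_trans ?_ hn)
    refine mul_le_mul_of_nonneg_left ?_ hc.le
    exact Real.rpow_le_rpow_of_exponent_le (by exact_mod_cast hn1)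
      (by linarith [min_le_left ε (1 / 10)])
  · refine key (γ := -α) (by linarith) hκi (Eventually.of_forall fun n hn => ?_)
    rw [Real.rpow_neg hn.le]
    have := Real.rpow_pos_of_pos hn α
    field_simp
  · refine key (γ := -β) (by linarith) hρi (Eventually.of_forall fun n hn => ?_)
    rw [Real.rpow_neg hn.le]
    have := Real.rpow_pos_of_pos hn β
    field_simp
  · refine key (γ := β - α) (by linarith) (hρ.mul hκi) (Eventually.of_forall fun n hn => ?_)
    rw [Real.rpow_sub hn]
    have := Real.rpow_pos_of_pos hn α
    have := Real.rpow_pos_of_pos hn β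
    field_simp
  · refine key (γ := α - 1) (by linarith) hκ (Eventually.of_forall fun n hn => ?_)
    rw [Real.rpow_sub hn, Real.rpow_one]
    have := Real.rpow_pos_of_pos hn α
    field_simp
  · refine key (γ := α + β - 1) (by linarith) (hρ.mul hκ) (Eventually.of_forall fun n hn => ?_)
    rw [Real.rpow_sub hn, Real.rpow_add hn, Real.rpow_one]
    have := Real.rpow_pos_of_pos hn α
    have := Real.rpow_pos_of_pos hn β
    field_simp
  · refine key (γ := β + (β + β) - 1) (by linarith) (hρ.mul (hρ.mul hρ))
      (Eventually.of_forall fun n hn => ?_)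
    rw [Real.rpow_sub hn, Real.rpow_add hn, Real.rpow_add hn, Real.rpow_one]
    have := Real.rpow_pos_of_pos hn β
    field_simp
  · refine key (γ := 1 - (β + (α + α))) (by linarith) (hρi.mul (hκi.mul hκi))
      (Eventually.of_forall fun n hn => ?_)
    rw [Real.rpow_sub hn, Real.rpow_add hn, Real.rpow_add hn, Real.rpow_one]
    have := Real.rpow_pos_of_pos hn α
    have := Real.rpow_pos_of_pos hn β
    field_simp
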